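/- There exists no simple, undirected, unweighted graph G with gc(G) = 3. -/

import Mathlib

open Matrix

def GCFeasible {V : Type*} [Fintype V] (A : Matrix V V ℝ) (m : ℕ) : Prop :=
  ∃ (k : ℕ) (P : Matrix (Fin k) V ℝ) (w : Fin k → ℝ),
    (∀ p i, P p i = 1 ∨ P p i = -1) ∧
    (∀ i, A i i = 0) ∧
    (∀ i j, i ≠ j → A i j = (Pᵀ * Matrix.diagonal w * P) i j) ∧
    m = (Finset.univ.filter fun p => w p ≠ 0).card

noncomputable def gc {V : Type*} [Fintype V] (A : Matrix V V ℝ) : ℕ :=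
  sInf { m | GCFeasible A m }

open scoped Classical in
noncomputable def gcGraph {V : Type*} [Fintype V] (G : SimpleGraph V) : ℕ :=
  gc (Matrix.of fun u v => if G.Adj u v then (1 : ℝ) else 0)

/-- For a weighted sum over three sign coordinates, the values at `x`, `y`, `x * y` and `1` add up
to an even integer combination of these values. -/
lemma sign_triple_sum (w₁ w₂ w₃ x₁ x₂ x₃ y₁ y₂ y₃ F G H T : ℝ)
    (hx₁ : x₁ = 1 ∨ x₁ = -1) (hx₂ : x₂ = 1 ∨ x₂ = -1) (hx₃ : x₃ = 1 ∨ x₃ = -1)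
    (hy₁ : y₁ = 1 ∨ y₁ = -1) (hy₂ : y₂ = 1 ∨ y₂ = -1) (hy₃ : y₃ = 1 ∨ y₃ = -1)
    (hF : F = w₁ * x₁ + w₂ * x₂ + w₃ * x₃) (hG : G = w₁ * y₁ + w₂ * y₂ + w₃ * y₃)
    (hH : H = w₁ * (x₁ * y₁) + w₂ * (x₂ * y₂) + w₃ * (x₃ * y₃)) (hT : T = w₁ + w₂ + w₃) :
    F + G + H + T = 0 ∨ F + G + H + T = 4 * T ∨ F + G + H + T = 2 * (T + F) ∨
      F + G + H + T = 2 * (T + G) ∨ F + G + H + T = 2 * (T + H) := by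
  subst hF hG hH hT
  rcases hx₁ with rfl | rfl <;> rcases hx₂ with rfl | rfl <;> rcases hx₃ with rfl | rfl <;>
  rcases hy₁ with rfl | rfl <;> rcases hy₂ with rfl | rfl <;> rcases hy₃ with rfl | rfl <;>
  first
    | (left; ring1)
    | (right; left; ring1)
    | (right; right; left; ring1)
    | (right; right; right; left; ring1)
    | (right; right; right; right; ring1)

/-- Two sign vectors of length three that agree up to a global sign. -/
def Collinear₃ (u v : Fin 3 → ℝ) : Prop :=
  (∀ p, u p = v p) ∨ ∀ p, u p = -v p

lemma collinear₃_or_product (s t u v : Fin 3 → ℝ)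
    (hs : ∀ p, s p = 1 ∨ s p = -1) (ht : ∀ p, t p = 1 ∨ t p = -1)
    (hu : ∀ p, u p = 1 ∨ u p = -1) (hv : ∀ p, v p = 1 ∨ v p = -1) :
    Collinear₃ s t ∨ Collinear₃ s u ∨ Collinear₃ s v ∨ Collinear₃ t u ∨ Collinear₃ t v ∨
      Collinear₃ u v ∨ Collinear₃ (fun p => s p * t p) (fun p => u p * v p) := by
  have rel : ∀ u v : Fin 3 → ℝ, (∀ p, u p = 1 ∨ u p = -1) → (∀ p, v p = 1 ∨ v p = -1) →
      (Collinear₃ u v ↔ u 0 * u 1 = v 0 * v 1 ∧ u 0 * u 2 = v 0 * v 2) := by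
    intro u v hu hv
    simp only [Collinear₃, Fin.forall_fin_succ, IsEmpty.forall_iff, and_true]
    rcases hu 0 with h₁ | h₁ <;> rcases hu 1 with h₂ | h₂ <;> rcases hu 2 with h₃ | h₃ <;>
    rcases hv 0 with h₄ | h₄ <;> rcases hv 1 with h₅ | h₅ <;> rcases hv 2 with h₆ | h₆ <;>
    simp [h₁, h₂, h₃, h₄, h₅, h₆] <;> norm_num
  have hmul : ∀ {x y : ℝ}, x = 1 ∨ x = -1 → y = 1 ∨ y = -1 → x * y = 1 ∨ x * y = -1 := by
    rintro x y (rfl | rfl) (rfl | rfl) <;> simp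
  rw [rel s t hs ht, rel s u hs hu, rel s v hs hv, rel t u ht hu, rel t v ht hv, rel u v hu hv,
    rel _ _ (fun p => hmul (hs p) (ht p)) (fun p => hmul (hu p) (hv p))]
  simp only [mul_mul_mul_comm _ (t _), mul_mul_mul_comm _ (v _)]
  rcases hmul (hs 0) (hs 1) with h₁ | h₁ <;> rcases hmul (hs 0) (hs 2) with h₂ | h₂ <;>
  rcases hmul (ht 0) (ht 1) with h₃ | h₃ <;> rcases hmul (ht 0) (ht 2) with h₄ | h₄ <;>
  rcases hmul (hu 0) (hu 1) with h₅ | h₅ <;> rcases hmul (hu 0) (hu 2) with h₆ | h₆ <;>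
  rcases hmul (hv 0) (hv 1) with h₇ | h₇ <;> rcases hmul (hv 0) (hv 2) with h₈ | h₈ <;>
  norm_num [h₁, h₂, h₃, h₄, h₅, h₆, h₇, h₈]

section Coupling

variable {V : Type*} {w : Fin 3 → ℝ} {s : V → Fin 3 → ℝ} {a : V → V → ℤ}

lemma exists_int_sum_of_collinear₃ (hs : ∀ i p, s i p = 1 ∨ s i p = -1)
    (h : ∀ i j, i ≠ j → (a i j : ℝ) = ∑ p, w p * (s i p * s j p)) {i j : V} (hij : i ≠ j)
    (hc : Collinear₃ (s i) (s j)) : ∃ T : ℤ, (T : ℝ) = w 0 + w 1 + w 2 := by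
  have hsq : ∀ p, s j p * s j p = 1 := fun p => by rcases hs j p with h | h <;> simp [h]
  have h' := h i j hij
  rcases hc with hc | hc
  · refine ⟨a i j, ?_⟩
    simpa [hc, hsq, Fin.sum_univ_three] using h'
  · refine ⟨-a i j, ?_⟩
    push_cast
    rw [h']
    simp only [hc, neg_mul, hsq, Fin.sum_univ_three]
    ring

lemma even_triple (hs : ∀ i p, s i p = 1 ∨ s i p = -1)
    (h : ∀ i j, i ≠ j → (a i j : ℝ) = ∑ p, w p * (s i p * s j p)) {T : ℤ}
    (hT : (T : ℝ) = w 0 + w 1 + w 2) {i j k : V} (hij : i ≠ j) (hik : i ≠ k) (hjk : j ≠ k) :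
    Even (a i j + a i k + a j k + T) := by
  have hsq : ∀ p, s i p * s i p = 1 := fun p => by rcases hs i p with h | h <;> simp [h]
  have hsgn : ∀ j p, s i p * s j p = 1 ∨ s i p * s j p = -1 := fun j p => by
    rcases hs i p with h | h <;> rcases hs j p with h' | h' <;> simp [h, h']
  have hprod : ∀ p, s j p * s k p = (s i p * s j p) * (s i p * s k p) := fun p => by
    linear_combination (-(s j p * s k p)) * hsq p
  have hF := h i j hij
  have hG := h i k hik
  have hH := h j k hjk
  simp only [Fin.sum_univ_three] at hF hG hH
  simp only [hprod] at hH
  have := sign_triple_sum (w 0) (w 1) (w 2) _ _ _ _ _ _ _ _ _ _ (hsgn j 0) (hsgn j 1) (hsgn j 2)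
    (hsgn k 0) (hsgn k 1) (hsgn k 2) hF hG hH hT
  norm_cast at this
  rw [Int.even_iff]
  omega

lemma eq_of_collinear₃_mul (h01 : ∀ i j, a i j = 0 ∨ a i j = 1)
    (h : ∀ i j, i ≠ j → (a i j : ℝ) = ∑ p, w p * (s i p * s j p)) {i j k l : V}
    (hij : i ≠ j) (hkl : k ≠ l)
    (hc : Collinear₃ (fun p => s i p * s j p) (fun p => s k p * s l p)) : a i j = a k l := by
  have h₁ := h i j hij
  have h₂ := h k l hkl
  have : a i j = a k l ∨ a i j = -a k l := by
    rcases hc with hc | hc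
    · left
      simp only [hc, ← h₂] at h₁
      exact_mod_cast h₁
    · right
      simp only [hc, mul_neg, Finset.sum_neg_distrib, ← h₂] at h₁
      exact_mod_cast h₁
  have := h01 i j
  have := h01 k l
  omega

lemma Collinear₃.mul_swap (hs : ∀ i p, s i p = 1 ∨ s i p = -1) {i j k l : V}
    (hc : Collinear₃ (fun p => s i p * s j p) (fun p => s k p * s l p)) :
    Collinear₃ (fun p => s i p * s k p) (fun p => s j p * s l p) := by
  refine hc.imp (fun hc p => ?_) (fun hc p => ?_) <;>
  · have hcp := hc p
    rcases hs i p with h₁ | h₁ <;> rcases hs j p with h₂ | h₂ <;>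
    rcases hs k p with h₃ | h₃ <;> rcases hs l p with h₄ | h₄ <;>
    simp only [h₁, h₂, h₃, h₄] at hcp ⊢ <;> linarith

lemma even_four_cycle (hs : ∀ i p, s i p = 1 ∨ s i p = -1) (h01 : ∀ i j, a i j = 0 ∨ a i j = 1)
    (h : ∀ i j, i ≠ j → (a i j : ℝ) = ∑ p, w p * (s i p * s j p)) {i j k l : V}
    (hij : i ≠ j) (hik : i ≠ k) (hil : i ≠ l) (hjk : j ≠ k) (hjl : j ≠ l) (hkl : k ≠ l) :
    Even (a i k + a j k + a i l + a j l) := by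
  have of_int : (∃ T : ℤ, (T : ℝ) = w 0 + w 1 + w 2) → Even (a i k + a j k + a i l + a j l) := by
    rintro ⟨T, hT⟩
    have h₁ := even_triple hs h hT hij hik hjk
    have h₂ := even_triple hs h hT hij hil hjl
    rw [Int.even_iff] at *
    omega
  rcases collinear₃_or_product (s i) (s j) (s k) (s l) (hs i) (hs j) (hs k) (hs l) with
    hc | hc | hc | hc | hc | hc | hc
  · exact of_int (exists_int_sum_of_collinear₃ hs h hij hc)
  · exact of_int (exists_int_sum_of_collinear₃ hs h hik hc)
  · exact of_int (exists_int_sum_of_collinear₃ hs h hil hc)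
  · exact of_int (exists_int_sum_of_collinear₃ hs h hjk hc)
  · exact of_int (exists_int_sum_of_collinear₃ hs h hjl hc)
  · exact of_int (exists_int_sum_of_collinear₃ hs h hkl hc)
  · have h₁ := eq_of_collinear₃_mul h01 h hik hjl (hc.mul_swap hs)
    have hc' : Collinear₃ (fun p => s i p * s j p) (fun p => s l p * s k p) := by
      simpa only [mul_comm (s l _)] using hc
    have h₂ := eq_of_collinear₃_mul h01 h hil hjk (hc'.mul_swap hs)
    rw [Int.even_iff]
    omega

end Coupling

/-- A graph in which all four-cycles of vertex pairs carry an even number of edges is complete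
bipartite or a disjoint union of two cliques (either side possibly empty). -/
lemma exists_bipartition_of_even_four_cycle {V : Type*} {a : V → V → ℤ}
    (hsymm : ∀ i j, a i j = a j i) (h01 : ∀ i j, a i j = 0 ∨ a i j = 1) (hdiag : ∀ i, a i i = 0)
    (h : ∀ i j k l, i ≠ j → i ≠ k → i ≠ l → j ≠ k → j ≠ l → k ≠ l →
      Even (a i k + a j k + a i l + a j l)) :
    ∃ S : Set V, (∀ i j, i ≠ j → (a i j = 1 ↔ (i ∈ S ↔ j ∈ S))) ∨
      ∀ i j, i ≠ j → (a i j = 1 ↔ ¬(i ∈ S ↔ j ∈ S)) := by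
  rcases isEmpty_or_nonempty V with hV | ⟨⟨o⟩⟩
  · exact ⟨∅, Or.inl fun i => hV.elim i⟩
  by_cases he : ∀ i j, i ≠ j → o ≠ i → o ≠ j → Even (a o i + a o j + a i j)
  · refine ⟨{i | a o i = 1}, Or.inr fun i j hij => ?_⟩
    have hi := h01 o i
    have hj := h01 o j
    have hij' := h01 i j
    simp only [Set.mem_ofPred_eq]
    by_cases hoi : o = i
    · subst hoi
      have := hdiag o
      omega
    by_cases hoj : o = j
    · subst hoj
      have := hdiag o
      have := hsymm i o
      omega
    have := he i j hij hoi hoj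
    rw [Int.even_iff] at this
    omega
  · push Not at he
    obtain ⟨p, q, hpq, hop, hoq, hodd⟩ := he
    have step : ∀ i j k, i ≠ j → i ≠ k → o ≠ i → o ≠ j → o ≠ k →
        Odd (a o i + a o j + a i j) → Odd (a o i + a o k + a i k) := by
      intro i j k hij hik hoi hoj hok hodd
      rcases eq_or_ne j k with rfl | hjk
      · exact hodd
      have := h o i j k hoi hoj hok hij hik hjk
      rw [Int.even_iff] at this
      rw [Int.odd_iff] at *
      omega
    have swap : ∀ i j, Odd (a o i + a o j + a i j) → Odd (a o j + a o i + a j i) := by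
      intro i j hodd
      rwa [hsymm j i, add_comm (a o j)]
    have all : ∀ i j, i ≠ j → o ≠ i → o ≠ j → Odd (a o i + a o j + a i j) := by
      rw [Int.not_even_iff_odd] at hodd
      intro i j hij hoi hoj
      rcases eq_or_ne p j with rfl | hpj
      · exact swap _ _ (step p q i hpq hij.symm hop hoq hoi hodd)
      · exact swap _ _ (step j p i hpj.symm hij.symm hoj hop hoi
          (swap _ _ (step p q j hpq hpj hop hoq hoj hodd)))
    refine ⟨{i | o = i ∨ a o i = 1}, Or.inl fun i j hij => ?_⟩
    have hi := h01 o i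
    have hj := h01 o j
    have hij' := h01 i j
    simp only [Set.mem_ofPred_eq]
    by_cases hoi : o = i
    · subst hoi
      simp [hij]
    by_cases hoj : o = j
    · subst hoj
      simp [hij.symm, hsymm i o]
    have := all i j hij hoi hoj
    rw [Int.odd_iff] at this
    simp only [hoi, hoj, false_or]
    omega

lemma transpose_mul_diagonal_mul_apply {V : Type*} {k : ℕ}
    (P : Matrix (Fin k) V ℝ) (w : Fin k → ℝ) (i j : V) :
    (Pᵀ * Matrix.diagonal w * P) i j = ∑ p, w p * (P p i * P p j) := by
  rw [Matrix.mul_apply]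
  simp only [Matrix.mul_diagonal, Matrix.transpose_apply]
  exact Finset.sum_congr rfl fun p _ => by ring

/-- A weight-two representation from an all-ones row and the sign vector of a set `S`. -/
lemma gcFeasible_two {V : Type*} [Fintype V] (A : Matrix V V ℝ) (S : Set V) (ε : ℝ) (hε : ε ≠ 0)
    (hdiag : ∀ i, A i i = 0) (hsame : ∀ i j, i ≠ j → (i ∈ S ↔ j ∈ S) → A i j = 1 / 2 + ε)
    (hdiff : ∀ i j, i ≠ j → ¬(i ∈ S ↔ j ∈ S) → A i j = 1 / 2 - ε) : GCFeasible A 2 := by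
  classical
  refine ⟨2, Matrix.of ![fun _ => 1, fun i => if i ∈ S then 1 else -1],
    ![1 / 2, ε], ?_, hdiag, ?_, ?_⟩
  · intro p i
    fin_cases p
    · simp
    · by_cases hi : i ∈ S <;> simp [hi]
  · intro i j hij
    rw [transpose_mul_diagonal_mul_apply]
    have h₁ := hsame i j hij
    have h₂ := hdiff i j hij
    by_cases hi : i ∈ S <;> by_cases hj : j ∈ S <;> simp_all [Fin.sum_univ_two] <;> ring
  · rw [Finset.filter_true_of_mem]
    · simp
    · intro p _
      fin_cases p <;> simp [hε]

lemma GCFeasible.exists_three {V : Type*} [Fintype V] {A : Matrix V V ℝ} (h : GCFeasible A 3) :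
    ∃ (w : Fin 3 → ℝ) (s : V → Fin 3 → ℝ), (∀ i p, s i p = 1 ∨ s i p = -1) ∧
      ∀ i j, i ≠ j → A i j = ∑ p, w p * (s i p * s j p) := by
  obtain ⟨k, P, w, hP, -, hA, hcard⟩ := h
  let e := (Finset.univ.filter fun p => w p ≠ 0).equivFinOfCardEq hcard.symm
  refine ⟨fun q => w (e.symm q), fun i q => P (e.symm q) i, fun i q => hP _ i, fun i j hij => ?_⟩
  rw [hA i j hij, transpose_mul_diagonal_mul_apply,
    Equiv.sum_comp e.symm (fun p => w p * (P p i * P p j)),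
    Finset.sum_coe_sort _ (fun p => w p * (P p i * P p j)), Finset.sum_filter]
  refine Finset.sum_congr rfl fun p _ => ?_
  by_cases hp : w p = 0 <;> simp [hp]

/-- Theorem: there is no simple unweighted graph with graph coupling number 3. -/
theorem no_gc_eq_three : ¬ ∃ (n : ℕ) (G : SimpleGraph (Fin n)), gcGraph G = 3 := by
  classical
  rintro ⟨n, G, hG⟩
  unfold gcGraph gc at hG
  set A : Matrix (Fin n) (Fin n) ℝ := Matrix.of fun u v => if G.Adj u v then (1 : ℝ) else 0 with hA
  have hfeas : GCFeasible A 3 := by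
    have hne : {m | GCFeasible A m}.Nonempty := Nat.nonempty_of_pos_sInf (by omega)
    have := Nat.sInf_mem hne
    rwa [hG] at this
  suffices h : GCFeasible A 2 by
    have := Nat.sInf_le (show 2 ∈ {m | GCFeasible A m} from h)
    omega
  obtain ⟨w, s, hs, hrep⟩ := hfeas.exists_three
  let a : Fin n → Fin n → ℤ := fun i j => if G.Adj i j then 1 else 0
  have ha : ∀ i j, A i j = a i j := fun i j => by simp [a, hA]
  have hsymm : ∀ i j, a i j = a j i := fun i j => by simp [a, G.adj_comm]
  have h01 : ∀ i j, a i j = 0 ∨ a i j = 1 := fun i j => by by_cases h : G.Adj i j <;> simp [a, h]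
  have hdiag : ∀ i, a i i = 0 := fun i => by simp [a]
  have hrep' : ∀ i j, i ≠ j → (a i j : ℝ) = ∑ p, w p * (s i p * s j p) := fun i j hij => by
    rw [← ha, hrep i j hij]
  have hdiagA : ∀ i, A i i = 0 := fun i => by rw [ha, hdiag, Int.cast_zero]
  obtain ⟨S, hS | hS⟩ := exists_bipartition_of_even_four_cycle hsymm h01 hdiag
    fun i j k l hij hik hil hjk hjl hkl => even_four_cycle hs h01 hrep' hij hik hil hjk hjl hkl
  · refine gcFeasible_two A S (1 / 2) (by norm_num) hdiagA (fun i j hij h => ?_) fun i j hij h => ?_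
    · rw [ha, (hS i j hij).2 h]
      norm_num
    · rw [ha, (h01 i j).resolve_right fun h' => h ((hS i j hij).1 h')]
      norm_num
  · refine gcFeasible_two A S (-1 / 2) (by norm_num) hdiagA (fun i j hij h => ?_)
      fun i j hij h => ?_
    · rw [ha, (h01 i j).resolve_right fun h' => (hS i j hij).1 h' h]
      norm_num
    · rw [ha, (hS i j hij).2 h]
      norm_num
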